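/- arXiv:1803.06964 — 2 statements merged into one kernel-verified Lean document; each statement's English description precedes it below -/
import Mathlib

section
/- The function γ ↦ g_MLE⁻¹(γ) := min_{t∈ℝ} E[(Z − tV_γ)₊²] is a decreasing function of γ on [0,∞), where Z is standard normal and V_γ is an independent random variable with density 2ρ'(γt)φ(t). -/
open MeasureTheory ProbabilityTheory Filter
open scoped Topology NNReal ENNReal

noncomputable section

/-- `ρ(t) = log(1 + eᵗ)`. -/
def rho (t : ℝ) : ℝ := Real.log (1 + Real.exp t)

/-- The sigmoid `ρ'(t) = eᵗ/(1+eᵗ)`. -/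
def rho' (t : ℝ) : ℝ := Real.exp t / (1 + Real.exp t)

/-- `ρ''(t) = ρ'(t)(1 - ρ'(t))`. -/
def rho'' (t : ℝ) : ℝ := rho' t * (1 - rho' t)

/-- The proximal operator `prox_{λρ}(z)`, characterized by `t + λρ'(t) = z`. -/
def prox (lam z : ℝ) : ℝ := Function.invFun (fun t : ℝ => t + lam * rho' t) z

/-- Standard Gaussian measure on `ℝ`. -/
def gauss : Measure ℝ := gaussianReal 0 1

/-- Uniform measure on `[0,1]`. -/
def unif : Measure ℝ := volume.restrict (Set.Icc (0 : ℝ) 1)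

/-- `g_MLE⁻¹(γ) = min_t E[(Z - tV)₊²]`, where `Z` is standard normal and `V` is an
independent variable with density `2ρ'(γ·)φ(·)`. -/
def gMLEinv (γ : ℝ) : ℝ :=
  ⨅ t : ℝ, ∫ z, (∫ v, (max (z - t * v) 0) ^ 2 * (2 * rho' (γ * v)) ∂gauss) ∂gauss

/-- Negative log-likelihood of the logistic model. -/
def negLogLik {n p : ℕ} (X : Fin n → Fin p → ℝ) (y : Fin n → ℝ) (b : Fin p → ℝ) : ℝ :=
  ∑ i, (rho (∑ j, X i j * b j) - y i * ∑ j, X i j * b j)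

/-- Logistic responses: `y_i = 1(U_i ≤ ρ'(X_i'β))`, so that `P(y_i = 1 | X_i) = ρ'(X_i'β)`. -/
def resp {n p : ℕ} (X : Fin n → Fin p → ℝ) (U : Fin n → ℝ) (β : Fin p → ℝ) : Fin n → ℝ :=
  fun i => if U i ≤ rho' (∑ j, X i j * β j) then 1 else 0

/-- Joint law of the design matrix (i.i.d. `N(0, n⁻¹ I_p)` rows) and of independent
uniform variables used to generate logistic responses. -/
def designLaw (n p : ℕ) : Measure ((Fin n → Fin p → ℝ) × (Fin n → ℝ)) :=
  (Measure.pi fun _ : Fin n => Measure.pi fun _ : Fin p => gaussianReal 0 ((n : ℝ≥0))⁻¹).prod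
    (Measure.pi fun _ : Fin n => unif)

/-- Iterated expectation over two independent standard Gaussians. -/
def E2 (f : ℝ → ℝ → ℝ) : ℝ := ∫ z1, (∫ z2, f z1 z2 ∂gauss) ∂gauss

/-- The system (S) of three nonlinear equations in `(α, σ, λ)`, with parameters `(κ, γ)`.
Here `(Q₁, Q₂) = (γ Z₁, -αγ Z₁ + √κ σ Z₂)` is the centered bivariate Gaussian with
`Var(Q₁) = γ²`, `Cov(Q₁, Q₂) = -αγ²`, `Var(Q₂) = α²γ² + κσ²`. -/
def solvesS (κ γ α σ lam : ℝ) : Prop :=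
  σ ^ 2 = (1 / κ ^ 2) *
      E2 (fun z1 z2 => 2 * rho' (γ * z1) *
        (lam * rho' (prox lam (-(α * γ) * z1 + Real.sqrt κ * σ * z2))) ^ 2) ∧
  0 = E2 (fun z1 z2 => rho' (γ * z1) * (γ * z1) *
        (lam * rho' (prox lam (-(α * γ) * z1 + Real.sqrt κ * σ * z2)))) ∧
  1 - κ = E2 (fun z1 z2 => 2 * rho' (γ * z1) /
        (1 + lam * rho'' (prox lam (-(α * γ) * z1 + Real.sqrt κ * σ * z2))))

theorem rho'_pos (x : ℝ) : 0 < rho' x := by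
  unfold rho'; positivity

theorem rho'_neg (x : ℝ) : rho' (-x) = 1 - rho' x := by
  unfold rho'
  rw [Real.exp_neg]
  have h := Real.exp_pos x
  field_simp
  ring

theorem rho'_mono : Monotone rho' := by
  intro x y hxy
  unfold rho'
  have hx := Real.exp_pos x
  have hy := Real.exp_pos y
  rw [div_le_div_iff₀ (by positivity) (by positivity)]
  nlinarith [Real.exp_le_exp.mpr hxy]

theorem rho'_lt_one (x : ℝ) : rho' x < 1 := by
  linarith [rho'_pos (-x), rho'_neg x]

theorem half_le_rho' {x : ℝ} (hx : 0 ≤ x) : 1 / 2 ≤ rho' x := by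
  linarith [rho'_mono (show -x ≤ x by linarith), rho'_neg x]

theorem continuous_rho' : Continuous rho' := by
  unfold rho'
  exact Real.continuous_exp.div (by fun_prop) fun x => by positivity

instance isProbabilityMeasure_gauss : IsProbabilityMeasure gauss := by
  unfold gauss; infer_instance

theorem integral_comp_neg_gauss (f : ℝ → ℝ) : ∫ v, f (-v) ∂gauss = ∫ v, f v ∂gauss := by
  have h : gauss.map (fun v => -v) = gauss := by
    simp [gauss, gaussianReal_map_neg]
  conv_rhs => rw [← h]
  exact ((MeasurableEquiv.neg ℝ).measurableEmbedding.integral_map f).symm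

theorem integrable_comp_neg_gauss {f : ℝ → ℝ} (hf : Integrable f gauss) :
    Integrable (fun v => f (-v)) gauss := by
  have h : gauss.map (fun v => -v) = gauss := by
    simp [gauss, gaussianReal_map_neg]
  rw [← h] at hf
  exact hf.comp_measurable measurable_neg

theorem integrable_sq_gauss : Integrable (fun v : ℝ => v ^ 2) gauss :=
  (memLp_id_gaussianReal (μ := 0) (v := 1) 2).integrable_sq

/-- The integrand defining `gMLEinv`. -/
def posPartLoss (γ t z v : ℝ) : ℝ := (max (z - t * v) 0) ^ 2 * (2 * rho' (γ * v))

theorem posPartLoss_nonneg (γ t z v : ℝ) : 0 ≤ posPartLoss γ t z v :=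
  mul_nonneg (sq_nonneg _) (by linarith [rho'_pos (γ * v)])

theorem posPartLoss_le (γ t z v : ℝ) :
    posPartLoss γ t z v ≤ 4 * z ^ 2 + 4 * t ^ 2 * v ^ 2 := by
  have h : (max (z - t * v) 0) ^ 2 ≤ 2 * z ^ 2 + 2 * t ^ 2 * v ^ 2 := by
    rcases max_cases (z - t * v) 0 with ⟨h, _⟩ | ⟨h, _⟩ <;> rw [h] <;>
      nlinarith [sq_nonneg (z + t * v), sq_nonneg z, sq_nonneg (t * v)]
  have h' := rho'_lt_one (γ * v)
  unfold posPartLoss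
  nlinarith [sq_nonneg (max (z - t * v) 0)]

theorem continuous_posPartLoss (γ t : ℝ) :
    Continuous fun p : ℝ × ℝ => posPartLoss γ t p.1 p.2 := by
  have := continuous_rho'
  unfold posPartLoss
  fun_prop

theorem integrable_posPartLoss_prod (γ t : ℝ) :
    Integrable (fun p : ℝ × ℝ => posPartLoss γ t p.1 p.2) (gauss.prod gauss) := by
  refine Integrable.mono' (g := fun p => 4 * p.1 ^ 2 + 4 * t ^ 2 * p.2 ^ 2) ?_
    (continuous_posPartLoss γ t).aestronglyMeasurable (ae_of_all _ fun p => ?_)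
  · exact ((integrable_sq_gauss.comp_fst gauss).const_mul 4).add
      ((integrable_sq_gauss.comp_snd gauss).const_mul (4 * t ^ 2))
  · rw [Real.norm_of_nonneg (posPartLoss_nonneg ..)]
    exact posPartLoss_le ..

theorem integrable_posPartLoss (γ t z : ℝ) : Integrable (posPartLoss γ t z) gauss := by
  refine Integrable.mono' (g := fun v => 4 * z ^ 2 + 4 * t ^ 2 * v ^ 2) ?_
    ((continuous_posPartLoss γ t).comp (Continuous.prodMk_right z)).aestronglyMeasurable
    (ae_of_all _ fun v => ?_)
  · exact (integrable_const _).add (integrable_sq_gauss.const_mul _)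
  · rw [Real.norm_of_nonneg (posPartLoss_nonneg ..)]
    exact posPartLoss_le ..

/-- After symmetrizing in `v`, replacing `t` by `|t|` and increasing `γ` lowers the loss. -/
theorem posPartLoss_symm_le {γ₁ γ₂ : ℝ} (h₁ : 0 ≤ γ₁) (h : γ₁ ≤ γ₂) (t z v : ℝ) :
    posPartLoss γ₂ |t| z v + posPartLoss γ₂ |t| z (-v) ≤
      posPartLoss γ₁ t z v + posPartLoss γ₁ t z (-v) := by
  wlog hv : 0 ≤ v generalizing v
  · have := this (-v) (by linarith)
    rw [neg_neg] at this
    linarith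
  have hp₁ := half_le_rho' (mul_nonneg h₁ hv)
  have hp := rho'_mono (mul_le_mul_of_nonneg_right h hv)
  have hab : (max (z - |t| * v) 0) ^ 2 ≤ (max (z + |t| * v) 0) ^ 2 := by
    have : 0 ≤ |t| * v := by positivity
    gcongr
    linarith
  simp only [posPartLoss, mul_neg, rho'_neg, sub_neg_eq_add]
  rcases abs_cases t with ⟨ht, _⟩ | ⟨ht, _⟩ <;> rw [ht] at hab ⊢
  · nlinarith
  · simp only [neg_mul, sub_neg_eq_add, ← sub_eq_add_neg] at hab ⊢
    nlinarith

theorem integral_posPartLoss_le {γ₁ γ₂ : ℝ} (h₁ : 0 ≤ γ₁) (h : γ₁ ≤ γ₂) (t z : ℝ) :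
    ∫ v, posPartLoss γ₂ |t| z v ∂gauss ≤ ∫ v, posPartLoss γ₁ t z v ∂gauss := by
  have key (γ s : ℝ) : ∫ v, (posPartLoss γ s z v + posPartLoss γ s z (-v)) ∂gauss =
      2 * ∫ v, posPartLoss γ s z v ∂gauss := by
    have hi := integrable_posPartLoss γ s z
    rw [integral_add hi (integrable_comp_neg_gauss hi), integral_comp_neg_gauss, two_mul]
  have hint (γ s : ℝ) :
      Integrable (fun v => posPartLoss γ s z v + posPartLoss γ s z (-v)) gauss :=
    (integrable_posPartLoss γ s z).add (integrable_comp_neg_gauss (integrable_posPartLoss γ s z))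
  have := integral_mono (hint γ₂ |t|) (hint γ₁ t) (posPartLoss_symm_le h₁ h t z)
  rw [key, key] at this
  linarith

/-- `γ ↦ g_MLE⁻¹(γ) = min_t E[(Z - t V_γ)₊²]` is a decreasing function
of `γ` on `[0, ∞)`. -/
theorem gMLEinv_decreasing : AntitoneOn gMLEinv (Set.Ici (0 : ℝ)) := by
  intro γ₁ h₁ γ₂ _ h
  refine le_ciInf fun t => ?_
  refine (ciInf_le ⟨0, ?_⟩ |t|).trans ?_
  · rintro _ ⟨s, rfl⟩
    exact integral_nonneg fun z => integral_nonneg (posPartLoss_nonneg γ₂ s z)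
  · exact integral_mono (integrable_posPartLoss_prod γ₂ |t|).integral_prod_left
      (integrable_posPartLoss_prod γ₁ t).integral_prod_left (integral_posPartLoss_le h₁ h t)
end
end

section
/- Suppose the data (X_i, y_i), i = 1,…,n, with X_i ∈ ℝᵖ and y_i ∈ {0,1}, admit no separating or quasi-separating direction: for every nonzero b ∈ ℝᵖ there exists an index i with (2y_i − 1)⟨X_i, b⟩ < 0. Then the logistic negative log-likelihood ℓ(b') = Σ_{i=1}^n {ρ(⟨X_i, b'⟩) − y_i ⟨X_i, b'⟩} is coercive (ℓ(b') → ∞ as ‖b'‖ → ∞) and attains its minimum at some point of ℝᵖ; that is, the maximum-likelihood estimator exists. -/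
open MeasureTheory ProbabilityTheory Filter
open scoped Topology NNReal ENNReal

noncomputable section

/-- A continuous, positively homogeneous function which is positive away from the origin
dominates a positive multiple of the norm. -/
theorem exists_pos_mul_norm_le_of_homogeneous {E : Type*} [NormedAddCommGroup E]
    [NormedSpace ℝ E] [FiniteDimensional ℝ E] {g : E → ℝ} (hg : Continuous g)
    (hhom : ∀ (r : ℝ) (b : E), 0 ≤ r → g (r • b) = r * g b) (hpos : ∀ b, b ≠ 0 → 0 < g b) :
    ∃ c : ℝ, 0 < c ∧ ∀ b, c * ‖b‖ ≤ g b := by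
  have hzero : g 0 = 0 := by simpa using hhom 0 0 le_rfl
  have : ProperSpace E := FiniteDimensional.proper ℝ E
  have hunit : ∀ b : E, b ≠ 0 → ‖b‖⁻¹ • b ∈ Metric.sphere (0 : E) 1 := fun b hb => by
    simp [norm_smul, hb]
  rcases (Metric.sphere (0 : E) 1).eq_empty_or_nonempty with hS | hS
  · refine ⟨1, one_pos, fun b => ?_⟩
    by_cases hb : b = 0
    · simp [hb, hzero]
    · simpa [hS] using hunit b hb
  · obtain ⟨u, hu, hmin⟩ := (isCompact_sphere (0 : E) 1).exists_isMinOn hS hg.continuousOn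
    refine ⟨g u, hpos u (ne_zero_of_mem_unit_sphere ⟨u, hu⟩), fun b => ?_⟩
    by_cases hb : b = 0
    · simp [hb, hzero]
    · have hle : g u ≤ g (‖b‖⁻¹ • b) := hmin (hunit b hb)
      rw [hhom _ _ (by positivity), inv_mul_eq_div] at hle
      exact (le_div_iff₀ (norm_pos_iff.2 hb)).1 hle

theorem continuous_rho : Continuous rho :=
  (continuous_const.add Real.continuous_exp).log fun t => (by positivity : 1 + Real.exp t ≠ 0)

theorem self_le_rho (t : ℝ) : t ≤ rho t :=
  (Real.le_log_iff_exp_le (by positivity)).2 (by linarith)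

theorem rho_nonneg (t : ℝ) : 0 ≤ rho t :=
  Real.log_nonneg (by linarith [Real.exp_pos t])

theorem hinge_le_rho_sub {y : ℝ} (hy : y = 0 ∨ y = 1) (t : ℝ) :
    max (-((2 * y - 1) * t)) 0 ≤ rho t - y * t := by
  have h₁ := self_le_rho t
  have h₂ := rho_nonneg t
  rcases hy with rfl | rfl <;> exact max_le (by linarith) (by linarith)

theorem continuous_negLogLik {n p : ℕ} (X : Fin n → Fin p → ℝ) (y : Fin n → ℝ) :
    Continuous (negLogLik X y) := by
  have := continuous_rho
  unfold negLogLik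
  fun_prop

/-- If there is no separating or quasi-separating direction (for every
nonzero `b` some observation has `(2y_i - 1)⟨X_i, b⟩ < 0`), then the logistic negative
log-likelihood is coercive and attains its minimum: the MLE exists. -/
theorem no_separation_implies_mle_exists (n p : ℕ)
    (X : Fin n → Fin p → ℝ) (y : Fin n → ℝ) (hy : ∀ i, y i = 0 ∨ y i = 1)
    (hnosep : ∀ b : Fin p → ℝ, b ≠ 0 → ∃ i, (2 * y i - 1) * (∑ j, X i j * b j) < 0) :
    Tendsto (negLogLik X y) (Filter.cocompact (Fin p → ℝ)) atTop ∧
    ∃ b : Fin p → ℝ, ∀ b' : Fin p → ℝ, negLogLik X y b ≤ negLogLik X y b' := by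
  have hcoercive : Tendsto (negLogLik X y) (Filter.cocompact (Fin p → ℝ)) atTop := by
    obtain ⟨c, hc, hle⟩ := exists_pos_mul_norm_le_of_homogeneous
      (g := fun b : Fin p → ℝ => ∑ i, max (-((2 * y i - 1) * ∑ j, X i j * b j)) 0)
      (by fun_prop)
      (fun r b hr => by
        rw [Finset.mul_sum]
        refine Finset.sum_congr rfl fun i _ => ?_
        have hlin : ∑ j, X i j * (r • b) j = r * ∑ j, X i j * b j := by
          simp only [Pi.smul_apply, smul_eq_mul, Finset.mul_sum, mul_left_comm]
        rw [hlin, mul_max_of_nonneg _ _ hr, mul_zero]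
        congr 1
        ring)
      (fun b hb => by
        obtain ⟨i, hi⟩ := hnosep b hb
        exact Finset.sum_pos' (fun _ _ => le_max_right _ _)
          ⟨i, Finset.mem_univ i, lt_max_of_lt_left (neg_pos.2 hi)⟩)
    exact tendsto_atTop_mono
      (fun b => (hle b).trans (Finset.sum_le_sum fun i _ => hinge_le_rho_sub (hy i) _))
      ((tendsto_norm_cocompact_atTop (E := Fin p → ℝ)).const_mul_atTop hc)
  exact ⟨hcoercive, (continuous_negLogLik X y).exists_forall_le hcoercive⟩
end
end
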